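/- Let T > 0 and let K ∈ L¹(0,T) be nonnegative and nonincreasing on (0,T). Then for every t′ ∈ (0,T] and every absolutely continuous function y : [0,t′] → ℝ with integrable derivative y′, one has ∫₀^{t′} (K ∗ y′)(t) · y(t) dt ≥ −(1/2) · y(0)² · ∫₀^{t′} K(s) ds. In particular, K satisfies the coercivity assumption (A₂): ∫₀^{t′} (K ∗ y′)(t) y(t) dt ≥ −C |y(0)|² with the constant C = (1/2)‖K‖_{L¹(0,T)} independent of y and t′. -/

import Mathlib

open MeasureTheory Real Set

/-- Laplace convolution on (0,t): (f ∗ g)(t) = ∫₀ᵗ f(t−s) g(s) ds. -/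
noncomputable def conv (f g : ℝ → ℝ) (t : ℝ) : ℝ := ∫ s in Set.Ioc 0 t, f (t - s) * g s

theorem aux_parts (u : ℝ → ℝ) (hu : Integrable u) (y0 : ℝ) (Y : ℝ → ℝ)
    (hY : ∀ t, Y t = y0 + ∫ s in (0:ℝ)..t, u s) (a b : ℝ) :
    ∫ s in a..b, u s * Y s = (Y b ^ 2 - Y a ^ 2) / 2 := by
  have hYe : Y = fun t => y0 + ∫ s in (0:ℝ)..t, u s := funext hY
  have hii : ∀ a b, IntervalIntegrable u volume a b := fun a b => hu.intervalIntegrable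
  have hac : AbsolutelyContinuousOnInterval Y a b := by
    have h1 : AbsolutelyContinuousOnInterval (fun t => ∫ s in a..t, u s) a b :=
      (hii a b).absolutelyContinuousOnInterval_intervalIntegral left_mem_uIcc
    have h2 : AbsolutelyContinuousOnInterval (fun _ : ℝ => Y a) a b :=
      (LipschitzWith.const (Y a)).lipschitzOnWith.absolutelyContinuousOnInterval
    have h3 := h2.add h1
    have h4 : Y = (fun _ : ℝ => Y a) + (fun t => ∫ s in a..t, u s) := by
      funext t
      have := intervalIntegral.integral_add_adjacent_intervals (hii 0 a) (hii a t)
      simp only [Pi.add_apply, hY]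
      linarith
    rw [h4]
    exact h3
  have hd : ∀ᵐ x, HasDerivAt Y (u x) x := by
    filter_upwards [LocallyIntegrable.ae_hasDerivAt_integral hu.locallyIntegrable] with x hx
    rw [hYe]
    exact (hx 0).const_add y0
  have h := hac.integral_deriv_mul_eq_sub hac
  have h2 : ∫ x in a..b, deriv Y x * Y x + Y x * deriv Y x = ∫ x in a..b, 2 * (u x * Y x) := by
    apply intervalIntegral.integral_congr_ae
    filter_upwards [hd] with x hx _
    rw [hx.deriv]; ring
  rw [h2, intervalIntegral.integral_const_mul] at h
  linarith

theorem aux_level (k h : ℝ → ℝ) (M : ℝ) (hkneg : ∀ r ≤ 0, k r = 0)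
    (hkM : ∀ r, M ≤ r → k r = 0) (hka : AntitoneOn k (Ioi 0))
    (hc : ∀ c, 0 ≤ c → 0 ≤ ∫ r in Ioc 0 c, h r) (l : ℝ) (hl : 0 < l) :
    0 ≤ ∫ r in {r | l < k r}, h r := by
  set S := {r | l < k r} with hS
  rcases S.eq_empty_or_nonempty with he | hne
  · simp [he]
  have hpos : ∀ r ∈ S, 0 < r := by
    intro r hr
    by_contra hh
    have := hkneg r (not_lt.1 hh)
    simp only [hS, mem_ofPred_eq] at hr
    linarith
  have hbd : BddAbove S := ⟨M, by
    intro r hr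
    by_contra hh
    have := hkM r (not_le.1 hh).le
    simp only [hS, mem_ofPred_eq] at hr
    linarith⟩
  set c := sSup S
  have hsub : S ⊆ Ioc 0 c := fun r hr => ⟨hpos r hr, le_csSup hbd hr⟩
  have hsup : Ioo 0 c ⊆ S := by
    intro r hr
    obtain ⟨q, hq, hrq⟩ := exists_lt_of_lt_csSup hne hr.2
    have := hka (mem_Ioi.2 hr.1) (mem_Ioi.2 (hpos q hq)) hrq.le
    exact lt_of_lt_of_le hq this
  have hae : S =ᵐ[volume] Ioc 0 c := by
    apply Filter.EventuallyLE.antisymm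
    · exact hsub.eventuallyLE
    · exact Ioo_ae_eq_Ioc.symm.le.trans hsup.eventuallyLE
  rw [setIntegral_congr_set hae]
  obtain ⟨q, hq⟩ := hne
  exact hc c ((hpos q hq).le.trans (le_csSup hbd hq))

theorem aux_layer (k h : ℝ → ℝ) (M : ℝ) (hk0 : ∀ r, 0 ≤ k r) (hkneg : ∀ r ≤ 0, k r = 0)
    (hkM : ∀ r, M ≤ r → k r = 0) (hka : AntitoneOn k (Ioi 0))
    (hh : AEStronglyMeasurable h volume) (hkh : Integrable (fun r => k r * h r))
    (hc : ∀ c, 0 ≤ c → 0 ≤ ∫ r in Ioc 0 c, h r) :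
    0 ≤ ∫ r, k r * h r := by
  have hkm : Measurable k := by
    apply measurable_of_Ioi
    intro l
    rcases lt_or_ge l 0 with hl | hl
    · convert MeasurableSet.univ
      ext r
      simpa using lt_of_lt_of_le hl (hk0 r)
    · apply OrdConnected.measurableSet
      constructor
      intro x hx z hz w hw
      simp only [mem_preimage, mem_Ioi] at *
      have hx0 : 0 < x := by
        by_contra hn
        rw [hkneg x (not_lt.1 hn)] at hx
        linarith
      have hw0 : 0 < w := hx0.trans_le hw.1
      exact hz.trans_le (hka hw0 (hw0.trans_le hw.2) hw.2)
  let f : ℝ → ℝ → ℝ := fun r l => {p : ℝ × ℝ | p.2 < k p.1}.indicator (fun p => h p.1) (r, l)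
  have hfe : ∀ r, f r = (Iio (k r)).indicator (fun _ => h r) := by
    intro r; funext l
    simp only [f, indicator, mem_ofPred_eq, mem_Iio]
  have hvol : ∀ r, (volume.restrict (Ioi (0:ℝ))).real (Iio (k r)) = k r := by
    intro r
    rw [measureReal_restrict_apply measurableSet_Iio, inter_comm, Ioi_inter_Iio]
    simp [hk0 r]
  have hfin : ∀ r, (volume.restrict (Ioi (0:ℝ))) (Iio (k r)) ≠ ⊤ := by
    intro r
    rw [Measure.restrict_apply measurableSet_Iio, inter_comm, Ioi_inter_Iio]
    simp
  have hint : ∀ r, ∫ l in Ioi (0:ℝ), f r l = k r * h r := by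
    intro r
    rw [hfe, integral_indicator measurableSet_Iio, setIntegral_const, hvol, smul_eq_mul]
  have hF : Integrable (Function.uncurry f) (volume.prod (volume.restrict (Ioi (0:ℝ)))) := by
    have hm : AEStronglyMeasurable (Function.uncurry f)
        (volume.prod (volume.restrict (Ioi (0:ℝ)))) := by
      have : AEStronglyMeasurable (fun p : ℝ × ℝ => h p.1)
        (volume.prod (volume.restrict (Ioi (0:ℝ)))) := hh.comp_fst
      exact this.indicator (measurableSet_lt measurable_snd (hkm.comp measurable_fst))
    rw [integrable_prod_iff hm]
    refine ⟨Filter.Eventually.of_forall fun r => ?_, ?_⟩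
    · change Integrable (f r) _
      rw [hfe]
      exact (integrable_indicator_iff measurableSet_Iio).2 (integrableOn_const (hfin r))
    · convert hkh.norm using 1
      funext r
      change ∫ l in Ioi (0:ℝ), ‖f r l‖ = _
      rw [hfe]
      simp_rw [norm_indicator_eq_indicator_norm]
      rw [integral_indicator measurableSet_Iio, setIntegral_const, hvol, smul_eq_mul, norm_mul,
        Real.norm_of_nonneg (hk0 r)]
  have hsw := integral_integral_swap hF
  simp_rw [hint] at hsw
  rw [hsw]
  apply setIntegral_nonneg measurableSet_Ioi
  intro l hl
  have h1 : (fun r => f r l) = {r | l < k r}.indicator h := by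
    funext r
    simp only [f, indicator, mem_ofPred_eq]
  rw [h1, integral_indicator (measurableSet_lt measurable_const hkm)]
  exact aux_level k h M hkneg hkM hka hc l hl

/-- If `K ∈ L¹(0,T)` is nonnegative and nonincreasing on `(0,T)`, then for every
`t' ∈ (0,T]` and every absolutely continuous `y ∈ W^{1,1}(0,t')`,
`∫₀^{t'} (K ∗ y')(t) y(t) dt ≥ −(1/2) y(0)² ∫₀^{t'} K(s) ds`. -/
theorem coercivity_A2_of_nonneg_nonincreasing
    (T : ℝ) (hT : 0 < T) (K : ℝ → ℝ)
    (hK_int : IntegrableOn K (Set.Ioc 0 T))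
    (hK_nonneg : ∀ t ∈ Set.Ioo (0:ℝ) T, 0 ≤ K t)
    (hK_anti : AntitoneOn K (Set.Ioo 0 T)) :
    ∀ t' ∈ Set.Ioc (0:ℝ) T, ∀ y y' : ℝ → ℝ,
      IntegrableOn y' (Set.Ioc 0 t') →
      (∀ t ∈ Set.Icc (0:ℝ) t', y t = y 0 + ∫ s in Set.Ioc 0 t, y' s) →
      (∫ t in Set.Ioc 0 t', conv K y' t * y t) ≥
        -(1/2) * (y 0)^2 * ∫ s in Set.Ioc 0 t', K s := by
  intro t' ht' y y' hy' hy
  set u : ℝ → ℝ := (Ioc 0 t').indicator y' with hu_def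
  have hu : Integrable u := (integrable_indicator_iff measurableSet_Ioc).2 hy'
  set k : ℝ → ℝ := (Ioo 0 t').indicator K with hk_def
  have hsubT : Ioo 0 t' ⊆ Ioo 0 T := Ioo_subset_Ioo_right ht'.2
  have hk : Integrable k := (integrable_indicator_iff measurableSet_Ioo).2
    (hK_int.mono_set (hsubT.trans Ioo_subset_Ioc_self))
  have hk0 : ∀ r, 0 ≤ k r := fun r => indicator_nonneg (fun x hx => hK_nonneg x (hsubT hx)) r
  have hkneg : ∀ r ≤ 0, k r = 0 := fun r hr => indicator_of_notMem (fun h => not_lt.2 hr h.1) _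
  have hkM : ∀ r, t' ≤ r → k r = 0 := fun r hr => indicator_of_notMem (fun h => not_lt.2 hr h.2) _
  have hka : AntitoneOn k (Ioi 0) := by
    intro a ha b hb hab
    by_cases hbt : b < t'
    · have hb' : b ∈ Ioo 0 t' := ⟨hb, hbt⟩
      have ha' : a ∈ Ioo 0 t' := ⟨ha, hab.trans_lt hbt⟩
      rw [hk_def, indicator_of_mem ha', indicator_of_mem hb']
      exact hK_anti (hsubT ha') (hsubT hb') hab
    · rw [hkM b (not_lt.1 hbt)]
      exact hk0 a
  set Y : ℝ → ℝ := fun t => y 0 + ∫ s in (0:ℝ)..t, u s with hY_def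
  have hYy : ∀ t ∈ Icc 0 t', Y t = y t := by
    intro t ht
    rw [hy t ht]
    simp only [hY_def]
    rw [intervalIntegral.integral_of_le ht.1]
    congr 1
    apply setIntegral_congr_fun measurableSet_Ioc
    intro s hs
    exact indicator_of_mem (show s ∈ Ioc 0 t' from ⟨hs.1, hs.2.trans ht.2⟩) _
  have hYneg : ∀ t ≤ 0, Y t = y 0 := by
    intro t ht
    simp only [hY_def]
    have : ∫ s in (0:ℝ)..t, u s = 0 := by
      rw [intervalIntegral.integral_of_ge ht, neg_eq_zero]
      apply setIntegral_eq_zero_of_forall_eq_zero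
      intro s hs
      exact indicator_of_notMem (fun h => not_lt.2 hs.2 h.1) _
    rw [this, add_zero]
  have hYc : Continuous Y := by
    apply continuous_const.add
    exact intervalIntegral.continuous_primitive (fun a b => hu.intervalIntegrable) 0
  have hYb : ∀ t, ‖Y t‖ ≤ ‖y 0‖ + ∫ s, ‖u s‖ := by
    intro t
    refine (norm_add_le _ _).trans (add_le_add le_rfl ?_)
    refine intervalIntegral.norm_integral_le_integral_norm_uIoc.trans ?_
    exact setIntegral_le_integral hu.norm (Filter.Eventually.of_forall fun _ => norm_nonneg _)
  have hparts := aux_parts u hu (y 0) Y (fun _ => rfl)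
  have hdiff : ∀ a b, ∫ s in a..b, u s = Y b - Y a := by
    intro a b
    have := intervalIntegral.integral_add_adjacent_intervals
      (hu.intervalIntegrable (a := 0) (b := a)) (hu.intervalIntegrable (a := a) (b := b))
    simp only [hY_def]
    linarith
  set w : ℝ → ℝ := fun s => u s * Y s with hw_def
  have hw : Integrable w := hu.mul_bdd hYc.aestronglyMeasurable (Filter.Eventually.of_forall hYb)
  have hP1 : Integrable (fun p : ℝ × ℝ => k p.2 * u (p.1 - p.2)) (volume.prod volume) :=
    hk.convolution_integrand (ContinuousLinearMap.mul ℝ ℝ) hu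
  have hP2 : Integrable (fun p : ℝ × ℝ => k p.2 * w (p.1 - p.2)) (volume.prod volume) :=
    hk.convolution_integrand (ContinuousLinearMap.mul ℝ ℝ) hw
  -- rewriting the convolution
  have hconv : ∀ t ∈ Ioc 0 t', conv K y' t = ∫ r, k r * u (t - r) := by
    intro t ht
    rw [← integral_sub_left_eq_self (fun r => k r * u (t - r)) volume t]
    unfold conv
    rw [← integral_indicator measurableSet_Ioc]
    apply integral_congr_ae
    filter_upwards [compl_mem_ae_iff.2 (measure_singleton t)] with s hs
    have hs : s ≠ t := hs
    simp only [sub_sub_cancel]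
    by_cases h1 : s ∈ Ioc 0 t
    · have h2 : s ∈ Ioc 0 t' := ⟨h1.1, h1.2.trans ht.2⟩
      have h3 : t - s ∈ Ioo 0 t' :=
        ⟨sub_pos.2 (lt_of_le_of_ne h1.2 hs), by linarith [h1.1, ht.2]⟩
      rw [indicator_of_mem h1, hk_def, indicator_of_mem h3, hu_def, indicator_of_mem h2]
    · rw [indicator_of_notMem h1]
      by_cases h2 : 0 < s
      · have : t ≤ s := by
          by_contra h
          exact h1 ⟨h2, (not_le.1 h).le⟩
        rw [hkneg _ (by linarith), zero_mul]
      · rw [hu_def, indicator_of_notMem (fun h => h2 h.1), mul_zero]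
  -- pointwise inequality
  have hpt : ∀ᵐ t, ∫ r, k r * w (t - r) ≤ (∫ r, k r * u (t - r)) * Y t := by
    filter_upwards [hP1.prod_right_ae, hP2.prod_right_ae] with t h1 h2
    have heq : (fun r => k r * (u (t - r) * (Y t - Y (t - r)))) =
        fun r => k r * u (t - r) * Y t - k r * w (t - r) := by
      funext r
      simp only [hw_def]
      ring
    have key := aux_layer k (fun r => u (t - r) * (Y t - Y (t - r))) t' hk0 hkneg hkM hka
      ((hu.comp_sub_left t).aestronglyMeasurable.mul
        ((continuous_const.sub (hYc.comp (continuous_const.sub continuous_id))).aestronglyMeasurable))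
      (by rw [heq]; exact (h1.mul_const _).sub h2) (by
        intro c hc
        rw [← intervalIntegral.integral_of_le hc,
          intervalIntegral.integral_comp_sub_left (fun s => u s * (Y t - Y s)) t, sub_zero]
        have : ∫ s in (t - c)..t, u s * (Y t - Y s) =
            ∫ s in (t - c)..t, (u s * Y t - u s * Y s) := by
          congr 1
          funext s
          ring
        rw [this, intervalIntegral.integral_sub (hu.mul_const _).intervalIntegrable
          hw.intervalIntegrable, intervalIntegral.integral_mul_const, hdiff, hparts]
        nlinarith [sq_nonneg (Y t - Y (t - c))])
    rw [heq, integral_sub (h1.mul_const _) h2, integral_mul_const] at key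
    linarith
  have hI1 : Integrable (fun t => (∫ r, k r * u (t - r)) * Y t) :=
    hP1.integral_prod_left.mul_bdd hYc.aestronglyMeasurable (Filter.Eventually.of_forall hYb)
  have hI2 : Integrable (fun t => ∫ r, k r * w (t - r)) := hP2.integral_prod_left
  have hL : ∫ t in Ioc 0 t', conv K y' t * y t =
      ∫ t in Ioc 0 t', (∫ r, k r * u (t - r)) * Y t := by
    apply setIntegral_congr_fun measurableSet_Ioc
    intro t ht
    simp only
    rw [hconv t ht, hYy t ⟨ht.1.le, ht.2⟩]
  have hKk : ∫ s in Ioc 0 t', K s = ∫ s, k s := by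
    rw [hk_def, integral_indicator measurableSet_Ioo, integral_Ioc_eq_integral_Ioo]
  have hP2' : Integrable (Function.uncurry fun t r : ℝ => k r * w (t - r))
      ((volume.restrict (Ioc 0 t')).prod volume) := by
    have := hP2.mono_measure (Measure.prod_mono (Measure.restrict_le_self (s := Ioc 0 t')
      (μ := (volume : Measure ℝ))) (le_refl (volume : Measure ℝ)))
    exact this
  have hswap := integral_integral_swap hP2'
  have hfin : -(1/2) * (y 0)^2 * ∫ s, k s ≤ ∫ t in Ioc 0 t', ∫ r, k r * w (t - r) := by
    rw [hswap, ← integral_const_mul]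
    apply integral_mono (hk.const_mul _) hP2'.integral_prod_right
    intro r
    simp only [Function.uncurry_apply_pair]
    rw [integral_const_mul]
    rcases le_or_gt r 0 with hr | hr
    · simp [hkneg r hr]
    rw [← intervalIntegral.integral_of_le ht'.1.le,
      intervalIntegral.integral_comp_sub_right (fun s => w s) r, hparts,
      hYneg (0 - r) (by linarith)]
    nlinarith [mul_nonneg (hk0 r) (sq_nonneg (Y (t' - r)))]
  rw [ge_iff_le, hL, hKk]
  refine hfin.trans ?_
  exact setIntegral_mono_ae hI2.integrableOn hI1.integrableOn hpt
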